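/- arXiv:solv-int/9808008 — 4 statements merged into one kernel-verified Lean document; each statement's English description precedes it below -/
import Mathlib

section
/- Let n ≥ 2 and let a₁,…,aₙ ∈ ℂⁿ, with components a_{ip}, satisfy the Gram conditions Σ_{p=1}^{n} a_{ip}a_{jp} = δ_{i+j,n+1} for all 1 ≤ i,j ≤ n. On the open set U = {u ∈ ℝⁿ : τ₀(u) ≠ 0}, where τ₀(u) = Σ_{j=1}^{n} a_{nj}² u_j, define γ_{ik}(u) = −a_{ni}a_{nk}/τ₀(u) and the functions ψ_{i1} = −a_{ni}/τ₀, ψ_{in} = −a_{ni}·(u_i − (Σ_{j=1}^{n} a_{nj}²u_j²)/(2τ₀)), and ψ_{ik} = a_{ki} − (a_{ni}/τ₀)·Σ_{j=1}^{n} a_{kj}a_{nj}u_j for 2 ≤ k ≤ n−1. Then for every q ∈ {1,…,n} and all i: ∂ψ_{iq}/∂u_k = γ_{ik}·ψ_{kq} for every k ≠ i, and Σ_{k=1}^{n} ∂ψ_{iq}/∂u_k = 0. -/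
open Matrix Finset

/-- Partial derivative `∂f/∂u_k` of a function on `ℝⁿ`. -/
noncomputable def pd {n : ℕ} {E : Type*} [NormedAddCommGroup E] [NormedSpace ℝ E]
    (k : Fin n) (f : (Fin n → ℝ) → E) (u : Fin n → ℝ) : E :=
  fderiv ℝ f u (Pi.single k 1)

/-- `τ₀(u) = Σ_j a_{nj}² u_j`, where `ν` is the index of the last vector `aₙ`. -/
noncomputable def tau0 {n : ℕ} (a : Fin n → Fin n → ℂ) (ν : Fin n) (u : Fin n → ℝ) : ℂ :=
  ∑ j, (a ν j) ^ 2 * (u j : ℂ)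

/-- The rotation coefficients `γ_{ik} = −a_{ni}a_{nk}/τ₀`. -/
noncomputable def gam {n : ℕ} (a : Fin n → Fin n → ℂ) (ν : Fin n) (i k : Fin n)
    (u : Fin n → ℝ) : ℂ :=
  -(a ν i * a ν k) / tau0 a ν u

/-- The matrix `ψ_{iq}` of solutions of the linear system: column `q` (0-based index,
so `q = 0` is the column labelled `1` and `q = ν` (`= n−1`) is the column labelled `n`):
`ψ_{i1} = −a_{ni}/τ₀`, `ψ_{in} = −a_{ni}(u_i − (Σ_j a_{nj}²u_j²)/(2τ₀))`,
`ψ_{ik} = a_{ki} − (a_{ni}/τ₀)Σ_j a_{kj}a_{nj}u_j` for `2 ≤ k ≤ n−1`. -/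
noncomputable def psi {n : ℕ} (a : Fin n → Fin n → ℂ) (ν : Fin n) (i q : Fin n)
    (u : Fin n → ℝ) : ℂ :=
  if (q : ℕ) = 0 then -(a ν i) / tau0 a ν u
  else if (q : ℕ) + 1 = n then
    -(a ν i) * ((u i : ℂ) - (∑ j, (a ν j) ^ 2 * (u j : ℂ) ^ 2) / (2 * tau0 a ν u))
  else a q i - (a ν i / tau0 a ν u) * ∑ j, a q j * a ν j * (u j : ℂ)

lemma pd_eq_of_hasDerivAt {n : ℕ} {f : (Fin n → ℝ) → ℂ} {u : Fin n → ℝ} {k : Fin n} {c : ℂ}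
    (hf : DifferentiableAt ℝ f u)
    (h : HasDerivAt (fun t : ℝ => f (u + t • Pi.single k 1)) c 0) : pd k f u = c := by
  have h' : HasLineDerivAt ℝ f c u (Pi.single k 1) := h
  exact hf.lineDeriv_eq_fderiv.symm.trans h'.lineDeriv

lemma differentiableAt_coord {n : ℕ} (j : Fin n) (u : Fin n → ℝ) :
    DifferentiableAt ℝ (fun v : Fin n → ℝ => (v j : ℂ)) u :=
  Complex.ofRealCLM.differentiableAt.comp u (differentiableAt_apply j u)

lemma hasDerivAt_coord {n : ℕ} (u : Fin n → ℝ) (k j : Fin n) :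
    HasDerivAt (fun t : ℝ => (((u + t • Pi.single k 1 : Fin n → ℝ) j : ℝ) : ℂ))
      (if j = k then 1 else 0) 0 := by
  have h : HasDerivAt (fun t : ℝ => (u + t • Pi.single k 1 : Fin n → ℝ) j)
      (if j = k then 1 else 0) 0 := by
    have := ((hasDerivAt_id (0 : ℝ)).mul_const ((Pi.single k 1 : Fin n → ℝ) j)).const_add (u j)
    simpa [Pi.single_apply] using this
  simpa [apply_ite] using h.ofReal_comp

lemma differentiableAt_linear {n : ℕ} (w : Fin n → ℂ) (u : Fin n → ℝ) :
    DifferentiableAt ℝ (fun v : Fin n → ℝ => ∑ j, w j * (v j : ℂ)) u :=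
  DifferentiableAt.fun_sum fun j _ => (differentiableAt_coord j u).const_mul (w j)

lemma differentiableAt_quadratic {n : ℕ} (w : Fin n → ℂ) (u : Fin n → ℝ) :
    DifferentiableAt ℝ (fun v : Fin n → ℝ => ∑ j, w j * (v j : ℂ) ^ 2) u :=
  DifferentiableAt.fun_sum fun j _ => ((differentiableAt_coord j u).pow 2).const_mul (w j)

lemma hasDerivAt_linear {n : ℕ} (w : Fin n → ℂ) (u : Fin n → ℝ) (k : Fin n) :
    HasDerivAt (fun t : ℝ => ∑ j, w j * (((u + t • Pi.single k 1 : Fin n → ℝ) j : ℝ) : ℂ))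
      (w k) 0 := by
  have := HasDerivAt.fun_sum (u := univ) fun j _ => (hasDerivAt_coord u k j).const_mul (w j)
  simpa using this

lemma hasDerivAt_quadratic {n : ℕ} (w : Fin n → ℂ) (u : Fin n → ℝ) (k : Fin n) :
    HasDerivAt (fun t : ℝ => ∑ j, w j * (((u + t • Pi.single k 1 : Fin n → ℝ) j : ℝ) : ℂ) ^ 2)
      (2 * w k * (u k : ℂ)) 0 := by
  have := HasDerivAt.fun_sum (u := univ) fun j _ =>
    ((hasDerivAt_coord u k j).fun_pow 2).const_mul (w j)
  refine this.congr_deriv ?_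
  simp
  ring

section Columns

variable {n : ℕ} (a : Fin n → Fin n → ℂ) (ν i q k : Fin n) {u : Fin n → ℝ}

lemma differentiableAt_div_tau0 {f : (Fin n → ℝ) → ℂ} (hf : DifferentiableAt ℝ f u)
    (hu : tau0 a ν u ≠ 0) : DifferentiableAt ℝ (fun v => f v / tau0 a ν v) u := by
  simp only [div_eq_mul_inv]
  have hτ : DifferentiableAt ℝ (tau0 a ν) u := differentiableAt_linear (fun j => a ν j ^ 2) u
  exact hf.fun_mul (hτ.fun_inv hu)

lemma pd_psi_first (hu : tau0 a ν u ≠ 0) (hq : (q : ℕ) = 0) :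
    pd k (psi a ν i q) u = a ν i * a ν k ^ 2 / tau0 a ν u ^ 2 := by
  have he : psi a ν i q = fun v => -(a ν i) / tau0 a ν v := by
    funext v; simp [psi, hq]
  rw [he]
  have hτ := hasDerivAt_linear (fun j => a ν j ^ 2) u k
  apply pd_eq_of_hasDerivAt
  · exact differentiableAt_div_tau0 a ν (differentiableAt_const _) hu
  · have := (hasDerivAt_const (0 : ℝ) (-(a ν i))).fun_div hτ (by simpa [tau0] using hu)
    refine this.congr_deriv ?_
    simp [tau0]

lemma pd_psi_last (hu : tau0 a ν u ≠ 0) (hq : (q : ℕ) ≠ 0) (hq' : (q : ℕ) + 1 = n) :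
    pd k (psi a ν i q) u = -(a ν i) * ((if i = k then 1 else 0)
      - (a ν k ^ 2 * (u k : ℂ) / tau0 a ν u
        - (∑ j, a ν j ^ 2 * (u j : ℂ) ^ 2) * a ν k ^ 2 / (2 * tau0 a ν u ^ 2))) := by
  have he : psi a ν i q = fun v => -(a ν i) *
      ((v i : ℂ) - (∑ j, (a ν j) ^ 2 * (v j : ℂ) ^ 2) / (2 * tau0 a ν v)) := by
    funext v; simp only [psi, if_neg hq, if_pos hq']
  rw [he]
  have hτ := (hasDerivAt_linear (fun j => a ν j ^ 2) u k).const_mul 2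
  apply pd_eq_of_hasDerivAt
  · simp only [← div_div]
    exact ((differentiableAt_coord i u).fun_sub
      (differentiableAt_div_tau0 a ν
        ((differentiableAt_quadratic (fun j => a ν j ^ 2) u).mul_const 2⁻¹) hu)).const_mul _
  · have := ((hasDerivAt_coord u k i).fun_sub
      ((hasDerivAt_quadratic (fun j => a ν j ^ 2) u k).fun_div hτ
        (by simpa [tau0] using hu))).const_mul (-(a ν i))
    refine this.congr_deriv ?_
    simp only [zero_smul, add_zero]
    change -(a ν i) * (_ - (_ * (2 * tau0 a ν u) - _) / (2 * tau0 a ν u) ^ 2) = _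
    field_simp

lemma pd_psi_middle (hu : tau0 a ν u ≠ 0) (hq : (q : ℕ) ≠ 0) (hq' : (q : ℕ) + 1 ≠ n) :
    pd k (psi a ν i q) u =
      a ν i * a ν k ^ 2 / tau0 a ν u ^ 2 * (∑ j, a q j * a ν j * (u j : ℂ))
        - a ν i / tau0 a ν u * (a q k * a ν k) := by
  have he : psi a ν i q = fun v =>
      a q i - (a ν i / tau0 a ν v) * ∑ j, a q j * a ν j * (v j : ℂ) := by
    funext v; simp only [psi, if_neg hq, if_neg hq']
  rw [he]
  have hτ := hasDerivAt_linear (fun j => a ν j ^ 2) u k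
  apply pd_eq_of_hasDerivAt
  · exact ((differentiableAt_div_tau0 a ν (differentiableAt_const _) hu).fun_mul
        (differentiableAt_linear (fun j => a q j * a ν j) u)).const_sub _
  · have := (((hasDerivAt_const (0 : ℝ) (a ν i)).fun_div hτ
      (by simpa [tau0] using hu)).fun_mul
        (hasDerivAt_linear (fun j => a q j * a ν j) u k)).const_sub (a q i)
    refine this.congr_deriv ?_
    simp only [zero_smul, add_zero]
    change -((_ - _) / (tau0 a ν u) ^ 2 * _ + a ν i / tau0 a ν u * _) = _
    field_simp
    ring

lemma pd_psi_of_ne (hu : tau0 a ν u ≠ 0) (hk : k ≠ i) :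
    pd k (psi a ν i q) u = gam a ν i k u * psi a ν k q u := by
  by_cases hq : (q : ℕ) = 0
  · rw [pd_psi_first a ν i q k hu hq]
    simp only [gam, psi, if_pos hq]
    field_simp
  by_cases hq' : (q : ℕ) + 1 = n
  · rw [pd_psi_last a ν i q k hu hq hq', if_neg hk.symm]
    simp only [gam, psi, if_neg hq, if_pos hq']
    field_simp
    ring
  · rw [pd_psi_middle a ν i q k hu hq hq']
    simp only [gam, psi, if_neg hq, if_neg hq']
    field_simp
    ring

lemma sum_pd_psi (hu : tau0 a ν u ≠ 0) (hiso : ∑ p, a ν p ^ 2 = 0)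
    (horth : (q : ℕ) ≠ 0 → ∑ p, a q p * a ν p = 0) :
    ∑ k, pd k (psi a ν i q) u = 0 := by
  by_cases hq : (q : ℕ) = 0
  · simp only [pd_psi_first a ν i q _ hu hq]
    rw [← Finset.sum_div, ← Finset.mul_sum, hiso]
    simp
  by_cases hq' : (q : ℕ) + 1 = n
  · simp only [pd_psi_last a ν i q _ hu hq hq']
    rw [← Finset.mul_sum, Finset.sum_sub_distrib, Finset.sum_sub_distrib, ← Finset.sum_div,
      ← Finset.sum_div, ← Finset.mul_sum, hiso]
    change _ * (_ - (tau0 a ν u / tau0 a ν u - _)) = 0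
    simp [hu]
  · simp only [pd_psi_middle a ν i q _ hu hq hq']
    rw [Finset.sum_sub_distrib, ← Finset.mul_sum, horth hq, ← Finset.sum_mul, ← Finset.sum_div,
      ← Finset.mul_sum, hiso]
    simp

end Columns

/-- For vectors `a₁,…,aₙ` with Gram matrix the anti-diagonal matrix, the functions
`ψ_{iq}` solve the linear system `∂ψ_{iq}/∂u_k = γ_{ik}ψ_{kq}` (`k ≠ i`),
`Σ_k ∂ψ_{iq}/∂u_k = 0` on `{τ₀ ≠ 0}`. -/
theorem example_eigenfunctions_solve_linear_system
    (n : ℕ) (hn : 2 ≤ n) (a : Fin n → Fin n → ℂ)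
    (hgram : ∀ i j, ∑ p, a i p * a j p
      = if (i : ℕ) + (j : ℕ) + 2 = n + 1 then (1 : ℂ) else 0) :
    ∀ u : Fin n → ℝ, tau0 a ⟨n - 1, by omega⟩ u ≠ 0 →
      ∀ q i : Fin n,
        (∀ k, k ≠ i →
          pd k (psi a ⟨n - 1, by omega⟩ i q) u
            = gam a ⟨n - 1, by omega⟩ i k u * psi a ⟨n - 1, by omega⟩ k q u) ∧
        ∑ k, pd k (psi a ⟨n - 1, by omega⟩ i q) u = 0 := by
  intro u hu q i
  refine ⟨fun k hk => pd_psi_of_ne a _ i q k hu hk, sum_pd_psi a _ i q hu ?_ fun hq => ?_⟩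
  · simp only [sq]
    rw [hgram, if_neg]
    simp only
    omega
  · rw [hgram, if_neg]
    simp only
    omega
end

section
/- Let n ≥ 2 and let a₁,…,aₙ ∈ ℂⁿ, with components a_{ip}, satisfy the Gram conditions Σ_{p=1}^{n} a_{ip}a_{jp} = δ_{i+j,n+1} for all 1 ≤ i,j ≤ n. On U = {u ∈ ℝⁿ : τ₀(u) ≠ 0} with τ₀(u) = Σ_{j=1}^{n} a_{nj}²u_j, define ψ_{i1} = −a_{ni}/τ₀, ψ_{in} = −a_{ni}·(u_i − (Σ_{j} a_{nj}²u_j²)/(2τ₀)), and ψ_{ik} = a_{ki} − (a_{ni}/τ₀)·Σ_{j} a_{kj}a_{nj}u_j for 2 ≤ k ≤ n−1. Then for all 1 ≤ α,β ≤ n and all u ∈ U: Σ_{i=1}^{n} ψ_{iα}(u)·ψ_{iβ}(u) = δ_{α+β,n+1}. In particular the Gram matrix η = (η_{αβ}) of the ψ-columns is the constant anti-diagonal matrix. -/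
open Matrix Finset

/-- Dot product of two combinations of a vector, `v`, and the coordinatewise product of `v`
and `w`. -/
theorem sum_combination_mul_combination {ι R : Type*} [Fintype ι] [CommRing R]
    (f g v w : ι → R) (x y z x' y' z' : R) :
    ∑ i, (x * f i + y * v i + z * (v i * w i)) * (x' * g i + y' * v i + z' * (v i * w i))
      = x * x' * ∑ i, f i * g i + x * y' * ∑ i, f i * v i + x * z' * ∑ i, f i * v i * w i
        + y * x' * ∑ i, g i * v i + y * y' * ∑ i, v i * v i
        + (y * z' + z * y') * ∑ i, v i ^ 2 * w i
        + z * x' * ∑ i, g i * v i * w i + z * z' * ∑ i, v i ^ 2 * w i ^ 2 := by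
  simp only [Finset.mul_sum, ← Finset.sum_add_distrib]
  exact Finset.sum_congr rfl fun i _ => by ring

theorem psi_of_val_eq_zero {n : ℕ} (a : Fin n → Fin n → ℂ) (ν i q : Fin n) (u : Fin n → ℝ)
    (hq : (q : ℕ) = 0) :
    psi a ν i q u = 0 * a q i + (-(tau0 a ν u)⁻¹) * a ν i + 0 * (a ν i * (u i : ℂ)) := by
  rw [psi, if_pos hq]
  ring

theorem psi_of_val_add_one_eq {n : ℕ} (a : Fin n → Fin n → ℂ) (ν i q : Fin n) (u : Fin n → ℝ)
    (hq₀ : (q : ℕ) ≠ 0) (hq : (q : ℕ) + 1 = n) :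
    psi a ν i q u = 0 * a q i
      + ((∑ j, (a ν j) ^ 2 * (u j : ℂ) ^ 2) / (2 * tau0 a ν u)) * a ν i
      + (-1) * (a ν i * (u i : ℂ)) := by
  rw [psi, if_neg hq₀, if_pos hq]
  ring

theorem psi_of_middle {n : ℕ} (a : Fin n → Fin n → ℂ) (ν i q : Fin n) (u : Fin n → ℝ)
    (hq₀ : (q : ℕ) ≠ 0) (hq : (q : ℕ) + 1 ≠ n) :
    psi a ν i q u = 1 * a q i
      + (-(∑ j, a q j * a ν j * (u j : ℂ)) / tau0 a ν u) * a ν i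
      + 0 * (a ν i * (u i : ℂ)) := by
  rw [psi, if_neg hq₀, if_neg hq]
  ring

/-- For vectors `a₁,…,aₙ` with Gram matrix the anti-diagonal matrix, the Gram matrix
`η_{αβ} = Σ_i ψ_{iα}ψ_{iβ}` of the `ψ`-columns is the constant anti-diagonal matrix:
`Σ_i ψ_{iα}ψ_{iβ} = δ_{α+β,n+1}`. -/
theorem example_flat_metric_antidiagonal
    (n : ℕ) (hn : 2 ≤ n) (a : Fin n → Fin n → ℂ)
    (hgram : ∀ i j, ∑ p, a i p * a j p
      = if (i : ℕ) + (j : ℕ) + 2 = n + 1 then (1 : ℂ) else 0) :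
    ∀ u : Fin n → ℝ, tau0 a ⟨n - 1, by omega⟩ u ≠ 0 →
      ∀ α β : Fin n,
        ∑ i, psi a ⟨n - 1, by omega⟩ i α u * psi a ⟨n - 1, by omega⟩ i β u
          = if (α : ℕ) + (β : ℕ) + 2 = n + 1 then (1 : ℂ) else 0 := by
  intro u hτ α β
  generalize hν : (⟨n - 1, by omega⟩ : Fin n) = ν at hτ ⊢
  have hν' : (ν : ℕ) = n - 1 := by rw [← hν]
  have hνν : ∑ p, a ν p * a ν p = 0 := by rw [hgram, if_neg (by omega)]
  have hmid : ∀ q : Fin n, (q : ℕ) ≠ 0 → ∑ p, a q p * a ν p = 0 := fun q hq => by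
    rw [hgram, if_neg (by omega)]
  have hsum : ∑ j, (a ν j) ^ 2 * (u j : ℂ) = tau0 a ν u := rfl
  by_cases hα₀ : (α : ℕ) = 0 <;> by_cases hβ₀ : (β : ℕ) = 0 <;>
    by_cases hα : (α : ℕ) + 1 = n <;> by_cases hβ : (β : ℕ) + 1 = n <;>
    first
    | omega
    | (simp only [psi_of_val_eq_zero, psi_of_val_add_one_eq, psi_of_middle, hα₀, hβ₀, hα, hβ,
        ne_eq, not_false_eq_true]
       rw [sum_combination_mul_combination, hsum, hνν]
       try rw [hmid α hα₀]
       try rw [hmid β hβ₀]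
       first
       | (rw [if_pos (by omega)]; field_simp; ring)
       | (rw [if_neg (by omega)]; field_simp; ring)
       | (rw [hgram]; ring))
end

section
/- Let n ≥ 2 and let a₁,…,aₙ ∈ ℂⁿ, with components a_{ip}, satisfy Σ_{p=1}^{n} a_{ip}a_{jp} = δ_{i+j,n+1}. On U = {u ∈ ℝⁿ : τ₀(u) ≠ 0} with τ₀(u) = Σ_{j} a_{nj}²u_j, define t₁ = −1/τ₀, tₙ = (Σ_{j} a_{nj}²u_j²)/(2τ₀), and t_α = −(Σ_{j} a_{αj}a_{nj}u_j)/τ₀ for 2 ≤ α ≤ n−1, and define ψ_{i1} = −a_{ni}/τ₀, ψ_{in} = −a_{ni}(u_i − (Σ_j a_{nj}²u_j²)/(2τ₀)), ψ_{iα} = a_{αi} − (a_{ni}/τ₀)Σ_j a_{αj}a_{nj}u_j (2 ≤ α ≤ n−1). Then for all 1 ≤ α ≤ n and 1 ≤ i ≤ n: ∂t_α/∂u_i = ψ_{i1}·ψ_{iα} on U. -/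
open Matrix Finset

/-- The flat coordinates with lower labels (indexed from `0`, so `α = 0` is `t₁` and
`α = ν` (`= n−1`) is `tₙ`): `t₁ = −1/τ₀`, `tₙ = (Σ_j a_{nj}²u_j²)/(2τ₀)`,
`t_α = −(Σ_j a_{αj}a_{nj}u_j)/τ₀` for `2 ≤ α ≤ n−1`. -/
noncomputable def tcoord {n : ℕ} (a : Fin n → Fin n → ℂ) (ν : Fin n) (α : Fin n)
    (u : Fin n → ℝ) : ℂ :=
  if (α : ℕ) = 0 then -1 / tau0 a ν u
  else if (α : ℕ) + 1 = n then (∑ j, (a ν j) ^ 2 * (u j : ℂ) ^ 2) / (2 * tau0 a ν u)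
  else -(∑ j, a α j * a ν j * (u j : ℂ)) / tau0 a ν u

/-- A coordinate `u ↦ u_j`, viewed as a complex-valued function, is differentiable. -/
lemma differentiableAt_ofReal_apply {n : ℕ} (j : Fin n) (u : Fin n → ℝ) :
    DifferentiableAt ℝ (fun u : Fin n → ℝ => ((u j : ℝ) : ℂ)) u :=
  (Complex.ofRealCLM.comp (ContinuousLinearMap.proj (R := ℝ) (φ := fun _ : Fin n => ℝ) j)
    ).differentiableAt

lemma pd_ofReal_apply {n : ℕ} (i j : Fin n) (u : Fin n → ℝ) :
    pd i (fun u : Fin n → ℝ => ((u j : ℝ) : ℂ)) u = if j = i then 1 else 0 := by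
  have h : HasFDerivAt (fun u : Fin n → ℝ => ((u j : ℝ) : ℂ))
      (Complex.ofRealCLM.comp
        (ContinuousLinearMap.proj (R := ℝ) (φ := fun _ : Fin n => ℝ) j)) u :=
    (Complex.ofRealCLM.comp
      (ContinuousLinearMap.proj (R := ℝ) (φ := fun _ : Fin n => ℝ) j)).hasFDerivAt
  rw [pd, h.fderiv]
  by_cases hij : j = i <;> simp [hij]

lemma differentiableAt_sum_mul_pow {n : ℕ} (c : Fin n → ℂ) (m : ℕ) (u : Fin n → ℝ) :
    DifferentiableAt ℝ (fun u : Fin n → ℝ => ∑ j, c j * (u j : ℂ) ^ m) u :=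
  DifferentiableAt.fun_sum fun j _ =>
    ((differentiableAt_ofReal_apply j u).fun_pow m).const_mul (c j)

lemma pd_sum_mul_pow {n : ℕ} (c : Fin n → ℂ) (m : ℕ) (i : Fin n) (u : Fin n → ℝ) :
    pd i (fun u : Fin n → ℝ => ∑ j, c j * (u j : ℂ) ^ m) u
      = c i * (m * (u i : ℂ) ^ (m - 1)) := by
  have h := HasFDerivAt.fun_sum (u := Finset.univ) fun j _ =>
    (((differentiableAt_ofReal_apply j u).hasFDerivAt).pow m).const_mul (c j)
  have hj := fun j => pd_ofReal_apply i j u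
  simp only [pd] at hj
  rw [pd, h.fderiv]
  simp [hj]

/-- The quotient rule for partial derivatives. -/
lemma pd_div {n : ℕ} {f g : (Fin n → ℝ) → ℂ} {u : Fin n → ℝ} (i : Fin n)
    (hf : DifferentiableAt ℝ f u) (hg : DifferentiableAt ℝ g u) (h0 : g u ≠ 0) :
    pd i (fun u => f u / g u) u = (pd i f u * g u - f u * pd i g u) / g u ^ 2 := by
  have hinv : HasFDerivAt (fun u => (g u)⁻¹) _ u :=
    ((hasDerivAt_inv h0).hasFDerivAt.restrictScalars ℝ).comp u hg.hasFDerivAt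
  simp only [div_eq_mul_inv (f _)]
  have hmul : HasFDerivAt (fun u => f u * (g u)⁻¹) _ u := hf.hasFDerivAt.mul' hinv
  rw [pd, hmul.fderiv]
  simp [pd]
  field_simp
  ring

/-- The quotient rule for a power sum divided by a nonvanishing linear form. -/
lemma pd_sum_mul_pow_div {n : ℕ} (b c : Fin n → ℂ) (m : ℕ) (i : Fin n) (u : Fin n → ℝ)
    (h0 : ∑ j, c j * (u j : ℂ) ≠ 0) :
    pd i (fun u : Fin n → ℝ => (∑ j, b j * (u j : ℂ) ^ m) / ∑ j, c j * (u j : ℂ)) u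
      = (b i * (m * (u i : ℂ) ^ (m - 1)) * (∑ j, c j * (u j : ℂ))
          - (∑ j, b j * (u j : ℂ) ^ m) * c i) / (∑ j, c j * (u j : ℂ)) ^ 2 := by
  have hd := differentiableAt_sum_mul_pow c 1 u
  have hp := pd_sum_mul_pow c 1 i u
  simp only [pow_one, Nat.cast_one, Nat.sub_self, pow_zero, mul_one] at hd hp
  rw [pd_div i (differentiableAt_sum_mul_pow b m u) hd h0, pd_sum_mul_pow, hp]

/-- The flat coordinates satisfy `∂t_α/∂u_i = ψ_{i1}ψ_{iα}` on `{τ₀ ≠ 0}`. -/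
theorem example_flat_coordinates
    (n : ℕ) (hn : 2 ≤ n) (a : Fin n → Fin n → ℂ)
    (hgram : ∀ i j, ∑ p, a i p * a j p
      = if (i : ℕ) + (j : ℕ) + 2 = n + 1 then (1 : ℂ) else 0) :
    ∀ u : Fin n → ℝ, tau0 a ⟨n - 1, by omega⟩ u ≠ 0 →
      ∀ α i : Fin n,
        pd i (tcoord a ⟨n - 1, by omega⟩ α) u
          = psi a ⟨n - 1, by omega⟩ i ⟨0, by omega⟩ u * psi a ⟨n - 1, by omega⟩ i α u := by
  intro u hu α i
  set ν : Fin n := ⟨n - 1, by omega⟩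
  by_cases h0 : (α : ℕ) = 0
  · have hc : DifferentiableAt ℝ (fun _ : Fin n → ℝ => (-1 : ℂ)) u := differentiableAt_const _
    have hd := differentiableAt_sum_mul_pow (fun j => a ν j ^ 2) 1 u
    have hp := pd_sum_mul_pow (fun j => a ν j ^ 2) 1 i u
    have hpc : pd i (fun _ : Fin n → ℝ => (-1 : ℂ)) u = 0 := by simp [pd]
    simp only [pow_one, Nat.cast_one, Nat.sub_self, pow_zero, mul_one] at hd hp
    have key := pd_div i hc hd hu
    rw [hp, hpc] at key
    have ht : tcoord a ν α = fun u => -1 / ∑ j, a ν j ^ 2 * (u j : ℂ) := by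
      funext v
      simp [tcoord, h0, tau0]
    rw [ht, key]
    simp only [psi, h0, if_true]
    change _ / tau0 a ν u ^ 2 = _
    field_simp
    ring
  · by_cases h1 : (α : ℕ) + 1 = n
    · have key := pd_sum_mul_pow_div (fun j => a ν j ^ 2 / 2) (fun j => a ν j ^ 2) 2 i u hu
      have hs : ∀ v : Fin n → ℝ, ∑ j, a ν j ^ 2 / 2 * (v j : ℂ) ^ 2
          = (∑ j, a ν j ^ 2 * (v j : ℂ) ^ 2) / 2 := fun v => by
        rw [Finset.sum_div]
        exact Finset.sum_congr rfl fun j _ => by ring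
      have ht : tcoord a ν α = fun v =>
          (∑ j, a ν j ^ 2 / 2 * (v j : ℂ) ^ 2) / ∑ j, a ν j ^ 2 * (v j : ℂ) := by
        funext v
        simp only [tcoord, h0, h1, if_true, if_false, tau0, hs, div_div]
      rw [ht, key, hs]
      simp only [psi, h0, h1, if_true, if_false]
      change (_ * tau0 a ν u - _) / tau0 a ν u ^ 2 = _
      field_simp
      push_cast
      ring
    · have key := pd_sum_mul_pow_div (fun j => -(a α j * a ν j)) (fun j => a ν j ^ 2) 1 i u hu
      have ht : tcoord a ν α = fun v =>
          (∑ j, -(a α j * a ν j) * (v j : ℂ) ^ 1) / ∑ j, a ν j ^ 2 * (v j : ℂ) := by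
        funext v
        simp [tcoord, h0, h1, tau0]
      rw [ht, key]
      simp only [psi, h0, h1, if_true, if_false, pow_one, neg_mul, Finset.sum_neg_distrib]
      change (-(_ * tau0 a ν u) - _) / tau0 a ν u ^ 2 = _
      field_simp
      push_cast
      ring
end

section
/- Let n ≥ 2 and let a₁,…,aₙ ∈ ℂⁿ, with components a_{ip}, satisfy Σ_{p=1}^{n} a_{ip}a_{jp} = δ_{i+j,n+1}, and assume a_{ni} ≠ 0 for every i. On U = {u ∈ ℝⁿ : τ₀(u) ≠ 0}, with τ₀(u) = Σ_{j} a_{nj}²u_j, define t₁ = −1/τ₀, tₙ = (Σ_{j} a_{nj}²u_j²)/(2τ₀), t_α = −(Σ_{j} a_{αj}a_{nj}u_j)/τ₀ for 2 ≤ α ≤ n−1, and set tᵅ := t_{n+1−α} for 1 ≤ α ≤ n. Then for every i and every u ∈ U (note t¹ⁿ... in particular tⁿ = t₁ = −1/τ₀ ≠ 0): u_i = t¹ − (1/(a_{ni}·tⁿ))·( a_{1i} − Σ_{α=2}^{n−1} ( a_{αi}·tᵅ + (a_{ni}/2)·tᵅ·t^{n+1−α} ) ). -/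
open Matrix Finset

/-- Dual completeness: the columns of a frame with anti-diagonal Gram matrix satisfy
`Σ_α a_{n+1−α,i} a_{αj} = δ_{ij}`. -/
theorem sum_rev_mul_eq_ite_of_gram {n : ℕ} (a : Fin n → Fin n → ℂ)
    (hgram : ∀ i j, ∑ p, a i p * a j p
      = if (i : ℕ) + (j : ℕ) + 2 = n + 1 then (1 : ℂ) else 0) (i j : Fin n) :
    ∑ α, a α.rev i * a α j = if i = j then 1 else 0 := by
  have h : (Matrix.of a) * (Matrix.of fun p α : Fin n => a α.rev p) = 1 := by
    ext k l
    simp only [Matrix.mul_apply, Matrix.of_apply, hgram, Matrix.one_apply, Fin.val_rev]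
    congr 1
    rw [Fin.ext_iff]
    apply propext
    omega
  have h' := congrArg (fun M : Matrix (Fin n) (Fin n) ℂ => M i j) (mul_eq_one_comm.mp h)
  simpa only [Matrix.mul_apply, Matrix.of_apply, Matrix.one_apply] using h'

/-- Expansion of a vector in a frame with anti-diagonal Gram matrix. -/
theorem eq_sum_rev_mul_of_gram {n : ℕ} (a : Fin n → Fin n → ℂ)
    (hgram : ∀ i j, ∑ p, a i p * a j p
      = if (i : ℕ) + (j : ℕ) + 2 = n + 1 then (1 : ℂ) else 0) (v : Fin n → ℂ) (i : Fin n) :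
    v i = ∑ α, a α i * ∑ j, a α.rev j * v j := by
  simp_rw [Finset.mul_sum]
  rw [Finset.sum_comm]
  have h (j : Fin n) : ∑ α, a α i * (a α.rev j * v j) = if j = i then v j else 0 := by
    simp_rw [mul_comm (a _ i), mul_right_comm, ← Finset.sum_mul,
      sum_rev_mul_eq_ite_of_gram a hgram, ite_mul, one_mul, zero_mul]
  simp [h]

/-- The bilinear square of a vector in terms of its coefficients in a frame with anti-diagonal
Gram matrix. -/
theorem sum_sq_eq_sum_mul_rev_of_gram {n : ℕ} (a : Fin n → Fin n → ℂ)
    (hgram : ∀ i j, ∑ p, a i p * a j p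
      = if (i : ℕ) + (j : ℕ) + 2 = n + 1 then (1 : ℂ) else 0) (v : Fin n → ℂ) :
    ∑ i, v i ^ 2 = ∑ α, (∑ j, a α.rev j * v j) * ∑ j, a α j * v j := by
  have h (i : Fin n) : v i ^ 2 = ∑ α, (∑ j, a α.rev j * v j) * (a α i * v i) := by
    rw [sq]
    nth_rewrite 1 [eq_sum_rev_mul_of_gram a hgram v i]
    rw [Finset.sum_mul]
    exact Finset.sum_congr rfl fun α _ => by ring
  simp_rw [h]
  rw [Finset.sum_comm]
  simp_rw [Finset.mul_sum]

/-- Splitting off the first and the last term of a sum over `Fin n`. -/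
theorem Fin.sum_eq_first_add_last_add_middle {M : Type*} [AddCommMonoid M] {n : ℕ} {o ν : Fin n}
    (ho : (o : ℕ) = 0) (hν : (ν : ℕ) + 1 = n) (hne : o ≠ ν) (f : Fin n → M) :
    ∑ α, f α = f o + f ν
      + ∑ δ ∈ Finset.univ.filter (fun δ : Fin n => (δ : ℕ) ≠ 0 ∧ (δ : ℕ) + 1 ≠ n), f δ := by
  have h : Finset.univ.filter (fun δ : Fin n => ¬((δ : ℕ) ≠ 0 ∧ (δ : ℕ) + 1 ≠ n)) = {o, ν} := by
    ext δ
    simp only [Finset.mem_filter, Finset.mem_univ, true_and, Finset.mem_insert,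
      Finset.mem_singleton, Fin.ext_iff]
    omega
  rw [← Finset.sum_filter_add_sum_filter_not Finset.univ
    (fun δ : Fin n => (δ : ℕ) ≠ 0 ∧ (δ : ℕ) + 1 ≠ n), h, Finset.sum_pair hne, add_comm]

/-- Inversion of the map from canonical to flat coordinates:
`u_i = t¹ − (1/(a_{ni}tⁿ))(a_{1i} − Σ_{α=2}^{n−1}(a_{αi}tᵅ + (a_{ni}/2)tᵅt^{n+1−α}))`,
where `tᵅ = t_{n+1−α}` (the sum runs over labels `α` with `2 ≤ α ≤ n−1`, i.e. over
`0`-based indices `δ = α − 1` with `δ ≠ 0` and `δ + 1 ≠ n`; in `0`-based indices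
`t¹ = tcoord ⟨n−1⟩`, `tⁿ = tcoord ⟨0⟩`, `tᵅ = tcoord ⟨n−1−δ⟩` and
`t^{n+1−α} = tcoord ⟨δ⟩`). -/
theorem example_canonical_coordinates_from_flat
    (n : ℕ) (hn : 2 ≤ n) (a : Fin n → Fin n → ℂ)
    (hgram : ∀ i j, ∑ p, a i p * a j p
      = if (i : ℕ) + (j : ℕ) + 2 = n + 1 then (1 : ℂ) else 0)
    (hne : ∀ i, a ⟨n - 1, by omega⟩ i ≠ 0) :
    ∀ u : Fin n → ℝ, tau0 a ⟨n - 1, by omega⟩ u ≠ 0 →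
      ∀ i : Fin n,
        (u i : ℂ) = tcoord a ⟨n - 1, by omega⟩ ⟨n - 1, by omega⟩ u
          - 1 / (a ⟨n - 1, by omega⟩ i * tcoord a ⟨n - 1, by omega⟩ ⟨0, by omega⟩ u) *
            (a ⟨0, by omega⟩ i
              - ∑ δ ∈ Finset.univ.filter (fun δ : Fin n => (δ : ℕ) ≠ 0 ∧ (δ : ℕ) + 1 ≠ n),
                  (a δ i * tcoord a ⟨n - 1, by omega⟩ ⟨n - 1 - (δ : ℕ), by omega⟩ u
                    + a ⟨n - 1, by omega⟩ i / 2
                      * tcoord a ⟨n - 1, by omega⟩ ⟨n - 1 - (δ : ℕ), by omega⟩ u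
                      * tcoord a ⟨n - 1, by omega⟩ δ u)) := by
  intro u hu i
  set ν : Fin n := ⟨n - 1, by omega⟩ with hν
  set o : Fin n := ⟨0, by omega⟩ with ho
  have ho₀ : (o : ℕ) = 0 := rfl
  have hν₁ : (ν : ℕ) + 1 = n := Nat.sub_add_cancel (by omega)
  have hoν : o ≠ ν := by rw [Ne, Fin.ext_iff]; omega
  have hrevo : o.rev = ν := by ext; simp [hν, ho]
  have hrevν : ν.rev = o := by ext; simp [hν, ho]; omega
  have hrev (δ : Fin n) : (⟨n - 1 - (δ : ℕ), by omega⟩ : Fin n) = δ.rev := by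
    ext; simp only [Fin.val_rev]; omega
  simp only [hrev]
  set x : Fin n → ℂ := fun α => ∑ j, a α j * (a ν j * u j)
  have hxν : x ν = tau0 a ν u := Finset.sum_congr rfl fun j _ => by ring
  have hto : tcoord a ν o u = -1 / tau0 a ν u := by simp [tcoord, ho]
  have htν : tcoord a ν ν u = (∑ j, (a ν j * u j) ^ 2) / (2 * tau0 a ν u) := by
    rw [tcoord, if_neg (by simp only [hν]; omega), if_pos (by simp only [hν]; omega)]
    simp_rw [mul_pow]
  have hmid (δ : Fin n) (h₀ : (δ : ℕ) ≠ 0) (h₁ : (δ : ℕ) + 1 ≠ n) :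
      x δ = -tau0 a ν u * tcoord a ν δ u := by
    rw [tcoord, if_neg h₀, if_neg h₁]
    field_simp
    exact Finset.sum_congr rfl fun j _ => by ring
  set s := Finset.univ.filter (fun δ : Fin n => (δ : ℕ) ≠ 0 ∧ (δ : ℕ) + 1 ≠ n)
  have hmem {δ : Fin n} (h : δ ∈ s) :
      x δ = -tau0 a ν u * tcoord a ν δ u ∧ x δ.rev = -tau0 a ν u * tcoord a ν δ.rev u := by
    obtain ⟨h₀, h₁⟩ := (Finset.mem_filter.mp h).2
    refine ⟨hmid δ h₀ h₁, hmid δ.rev ?_ ?_⟩ <;> rw [Fin.val_rev] <;> omega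
  have hlin : a ν i * u i = a o i * tau0 a ν u + a ν i * x o
      - tau0 a ν u * ∑ δ ∈ s, a δ i * tcoord a ν δ.rev u := by
    have h := eq_sum_rev_mul_of_gram a hgram (fun j => a ν j * u j) i
    rw [Fin.sum_eq_first_add_last_add_middle ho₀ hν₁ hoν] at h
    change _ = a o i * x o.rev + a ν i * x ν.rev + ∑ δ ∈ s, a δ i * x δ.rev at h
    rw [hrevo, hrevν, hxν] at h
    have hrest : ∑ δ ∈ s, a δ i * x δ.rev
        = -tau0 a ν u * ∑ δ ∈ s, a δ i * tcoord a ν δ.rev u := by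
      rw [Finset.mul_sum]
      exact Finset.sum_congr rfl fun δ hδ => by rw [(hmem hδ).2]; ring
    rw [h, hrest]
    ring
  have hquad : ∑ j, (a ν j * u j) ^ 2 = 2 * x o * tau0 a ν u
      + tau0 a ν u ^ 2 * ∑ δ ∈ s, tcoord a ν δ.rev u * tcoord a ν δ u := by
    have h := sum_sq_eq_sum_mul_rev_of_gram a hgram (fun j => a ν j * u j)
    rw [Fin.sum_eq_first_add_last_add_middle ho₀ hν₁ hoν
      fun α => (∑ j, a α.rev j * (a ν j * u j)) * ∑ j, a α j * (a ν j * u j)] at h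
    change _ = x o.rev * x o + x ν.rev * x ν + ∑ δ ∈ s, x δ.rev * x δ at h
    rw [hrevo, hrevν, hxν] at h
    have hrest : ∑ δ ∈ s, x δ.rev * x δ
        = tau0 a ν u ^ 2 * ∑ δ ∈ s, tcoord a ν δ.rev u * tcoord a ν δ u := by
      rw [Finset.mul_sum]
      exact Finset.sum_congr rfl fun δ hδ => by rw [(hmem hδ).1, (hmem hδ).2]; ring
    clear_value x
    linear_combination h + hrest
  have hsum : ∑ δ ∈ s, (a δ i * tcoord a ν δ.rev u
        + a ν i / 2 * tcoord a ν δ.rev u * tcoord a ν δ u)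
      = ∑ δ ∈ s, a δ i * tcoord a ν δ.rev u
        + a ν i / 2 * ∑ δ ∈ s, tcoord a ν δ.rev u * tcoord a ν δ u := by
    rw [Finset.sum_add_distrib, Finset.mul_sum]
    simp_rw [mul_assoc]
  have hai : a ν i ≠ 0 := hne i
  rw [hsum, hto, htν, hquad]
  field_simp
  linear_combination 2 * hlin
end
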